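/- Every quaternion tensor A ∈ H^{n1×n2×n3} has a Moore-Penrose inverse under the T-product. -/

import Mathlib

open scoped Quaternion BigOperators

noncomputable section

/-- A quaternion third-order tensor in `H^{n1 x n2 x n3}`, with the third
(circulant) index taken mod `n3`. -/
abbrev QT (n1 n2 n3 : ℕ) := Fin n1 → Fin n2 → ZMod n3 → ℍ[ℝ]

/-- The T-product of two quaternion tensors (circular convolution along the third mode). -/
def tmul {n1 n2 l n3 : ℕ} [NeZero n3] (A : QT n1 n2 n3) (B : QT n2 l n3) : QT n1 l n3 :=
  fun i j k => ∑ p : Fin n2, ∑ m : ZMod n3, A i p m * B p j (k - m)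

/-- The identity tensor: first frontal slice is the identity matrix, others zero. -/
def tid (n n3 : ℕ) : QT n n n3 := fun i j k => if i = j ∧ k = 0 then 1 else 0

/-- Conjugate transpose: conjugate-transpose each frontal slice and
reverse the order of slices 2 through n3. -/
def hconj {n1 n2 n3 : ℕ} (A : QT n1 n2 n3) : QT n2 n1 n3 :=
  fun j i k => star (A i j (-k))

/-- The four Penrose equations for the T-product. -/
def IsMP {n1 n2 n3 : ℕ} [NeZero n3] (A : QT n1 n2 n3) (X : QT n2 n1 n3) : Prop :=
  tmul (tmul A X) A = A ∧ tmul (tmul X A) X = X ∧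
    hconj (tmul A X) = tmul A X ∧ hconj (tmul X A) = tmul X A

open scoped Matrix

/-- The conjugate transpose of a quaternion matrix is a proper involution. -/
theorem Quaternion.conjTranspose_mul_self_eq_zero {m n : Type*} [Fintype m]
    {M : Matrix m n ℍ[ℝ]} (h : Mᴴ * M = 0) : M = 0 := by
  ext1 i j
  have hj : (Mᴴ * M) j j = 0 := by rw [h]; rfl
  have hsum : ∑ k, Quaternion.normSq (M k j) = 0 := by
    refine (algebraMap ℝ ℍ[ℝ]).injective ?_
    simpa [Matrix.mul_apply, Quaternion.star_mul_self, map_sum, Quaternion.algebraMap_def]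
      using hj
  rw [Finset.sum_eq_zero_iff_of_nonneg fun _ _ => Quaternion.normSq_nonneg] at hsum
  exact Quaternion.normSq_eq_zero.1 (hsum i (Finset.mem_univ i))

/-- The block circulant matrix of a tensor. -/
def circ {n1 n2 n3 : ℕ} (A : QT n1 n2 n3) :
    Matrix (Fin n1 × ZMod n3) (Fin n2 × ZMod n3) ℍ[ℝ] :=
  fun x y => A x.1 y.1 (x.2 - y.2)

theorem circ_injective {n1 n2 n3 : ℕ} :
    Function.Injective (circ : QT n1 n2 n3 → _) := by
  intro A B h
  funext i j k
  simpa [circ] using congrFun (congrFun h (i, k)) (j, 0)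

section

variable {n1 n2 l n3 : ℕ}

@[simp]
theorem circ_zero : circ (0 : QT n1 n2 n3) = 0 := rfl

@[simp]
theorem circ_add (A B : QT n1 n2 n3) : circ (A + B) = circ A + circ B := rfl

@[simp]
theorem circ_smul (c : ℝ) (A : QT n1 n2 n3) : circ (c • A) = c • circ A := rfl

@[simp]
theorem circ_hconj (A : QT n1 n2 n3) : circ (hconj A) = (circ A)ᴴ := by
  ext1 x y
  simp [circ, hconj, Matrix.conjTranspose_apply]

@[simp]
theorem circ_tid (n : ℕ) : circ (tid n n3) = 1 := by
  ext1 x y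
  simp [circ, tid, Matrix.one_apply, Prod.ext_iff, sub_eq_zero]

variable [NeZero n3]

@[simp]
theorem circ_tmul (A : QT n1 n2 n3) (B : QT n2 l n3) :
    circ (tmul A B) = circ A * circ B := by
  ext1 x y
  simp only [circ, tmul, Matrix.mul_apply, Fintype.sum_prod_type]
  refine Finset.sum_congr rfl fun p _ => ?_
  refine Fintype.sum_equiv (Equiv.subLeft x.2) _ _ fun m => ?_
  simp only [Equiv.subLeft_apply, sub_sub_cancel]
  rw [sub_right_comm]

/-- Left multiplication by a tensor under the T-product. -/
def tmulLeft (A : QT n1 n2 n3) : QT n2 l n3 →ₗ[ℝ] QT n1 l n3 where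
  toFun := tmul A
  map_add' X Y := circ_injective (by simp [Matrix.mul_add])
  map_smul' c X := circ_injective (by simp)

end

theorem LinearMap.range_comp_self_eq_of_ker_le {K V : Type*} [DivisionRing K] [AddCommGroup V]
    [Module K V] [FiniteDimensional K V] (T : V →ₗ[K] V)
    (h : LinearMap.ker (T ∘ₗ T) ≤ LinearMap.ker T) :
    LinearMap.range (T ∘ₗ T) = LinearMap.range T := by
  refine Submodule.eq_of_le_of_finrank_le (LinearMap.range_comp_le_range T T) ?_
  have h₁ := T.finrank_range_add_finrank_ker
  have h₂ := (T ∘ₗ T).finrank_range_add_finrank_ker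
  have h₃ := Submodule.finrank_mono h
  omega

theorem exists_tmul_self_tmul_eq {n n3 : ℕ} [NeZero n3] (B : QT n n n3) (hB : hconj B = B) :
    ∃ C : QT n n n3, tmul B (tmul B C) = B := by
  have hB' : (circ B)ᴴ = circ B := by rw [← circ_hconj, hB]
  have hker : LinearMap.ker (tmulLeft (l := n) B ∘ₗ tmulLeft B) ≤
      LinearMap.ker (tmulLeft B) := by
    intro Z hZ
    have hZ' : circ B * (circ B * circ Z) = 0 := by
      have hZ₀ : tmul B (tmul B Z) = 0 := hZ
      simpa using congrArg circ hZ₀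
    refine circ_injective (?_ : circ (tmul B Z) = circ 0)
    rw [circ_tmul, circ_zero]
    apply Quaternion.conjTranspose_mul_self_eq_zero
    rw [Matrix.conjTranspose_mul, hB', Matrix.mul_assoc, hZ', Matrix.mul_zero]
  have hmem : B ∈ LinearMap.range (tmulLeft (l := n) B) :=
    ⟨tid n n3, circ_injective (by simp [tmulLeft])⟩
  rw [← LinearMap.range_comp_self_eq_of_ker_le _ hker] at hmem
  exact hmem

theorem exists_tmul_hconj_tmul_eq {n1 n2 n3 : ℕ} [NeZero n3] (A : QT n1 n2 n3) :
    ∃ W : QT n1 n2 n3, tmul A (tmul (hconj A) W) = A := by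
  obtain ⟨C, hC⟩ := exists_tmul_self_tmul_eq (tmul (hconj A) A)
    (circ_injective (by simp))
  have hC' := congrArg circ hC
  simp only [circ_tmul, circ_hconj, Matrix.mul_assoc] at hC'
  refine ⟨tmul A C, circ_injective ?_⟩
  simp only [circ_tmul, circ_hconj]
  rw [← sub_eq_zero]
  apply Quaternion.conjTranspose_mul_self_eq_zero
  simp only [Matrix.conjTranspose_sub, Matrix.conjTranspose_mul, Matrix.conjTranspose_conjTranspose,
    Matrix.sub_mul, Matrix.mul_sub, Matrix.mul_assoc, hC', sub_self]

theorem moorePenrose_exists {n1 n2 n3 : ℕ} [NeZero n3]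
    (A : QT n1 n2 n3) : ∃ X : QT n2 n1 n3, IsMP A X := by
  obtain ⟨W, hW⟩ := exists_tmul_hconj_tmul_eq A
  obtain ⟨V, hV⟩ := exists_tmul_hconj_tmul_eq (hconj A)
  replace hW := congrArg circ hW
  replace hV := congrArg circ hV
  simp only [circ_tmul, circ_hconj, Matrix.conjTranspose_conjTranspose] at hW hV
  have hW' := congrArg Matrix.conjTranspose hW
  have hV' := congrArg Matrix.conjTranspose hV
  simp only [Matrix.conjTranspose_mul, Matrix.conjTranspose_conjTranspose] at hW' hV'
  have hAV : (circ V)ᴴ * (circ A)ᴴ = circ A * circ V := by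
    conv_lhs => rw [← hV]
    conv_rhs => rw [← hV']
    simp only [Matrix.mul_assoc]
  have hWA : (circ A)ᴴ * circ W = (circ W)ᴴ * circ A := by
    conv_lhs => rw [← hW']
    conv_rhs => rw [← hW]
    simp only [Matrix.mul_assoc]
  have hAVA : circ A * (circ V * circ A) = circ A := by
    rw [← Matrix.mul_assoc, ← hAV, hV']
  have hAWA : circ A * ((circ W)ᴴ * circ A) = circ A := by
    rw [← hWA, hW]
  have hAX : circ A * ((circ W)ᴴ * (circ A * circ V)) = circ A * circ V := by
    rw [← Matrix.mul_assoc (circ W)ᴴ, ← Matrix.mul_assoc, hAWA]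
  refine ⟨tmul (hconj W) (tmul A V), ?_, ?_, ?_, ?_⟩ <;> apply circ_injective <;>
    simp only [circ_tmul, circ_hconj, Matrix.mul_assoc, hAVA, hAX,
      Matrix.conjTranspose_mul, Matrix.conjTranspose_conjTranspose, hAV, hWA]
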